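/- The Fock representation Λ(W_cre) of the Clifford algebra Cl(W) associated to a polarization W = W_cre ⊕ W_ann is irreducible. Moreover, any nonzero subrepresentation of Λ(W_cre) contains the vacuum vector 1 ∈ Λ⁰(W_cre). -/

import Mathlib

noncomputable section

variable {W : Type*} [AddCommGroup W] [Module ℂ W]

/-- The Fock-space action of a vector `w ∈ W` on `Λ(W_cre)`: the creation part of `w`
acts by left wedging, the annihilation part by contraction against `B`. -/
def fockOp (B : W →ₗ[ℂ] W →ₗ[ℂ] ℂ) (Wcre Wann : Submodule ℂ W)
    (hc : IsCompl Wcre Wann) (w : W) :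
    ExteriorAlgebra ℂ Wcre →ₗ[ℂ] ExteriorAlgebra ℂ Wcre :=
  LinearMap.mulLeft ℂ
      (ExteriorAlgebra.ι ℂ (Submodule.linearProjOfIsCompl Wcre Wann hc w))
    + CliffordAlgebra.contractLeft (Q := (0 : QuadraticForm ℂ ↥Wcre))
        ((B ((Submodule.linearProjOfIsCompl Wann Wcre hc.symm w : Wann) : W)).comp
          Wcre.subtype)

namespace ExteriorAlgebra

open CliffordAlgebra (contractLeft contractLeft_ι_mul contractLeft_comm
  contractLeft_contractLeft)

variable {K V α : Type*} [Field K] [AddCommGroup V] [Module K V] [Fintype α]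

/-- The number operator `∑ i, e i ∧ (e^i ⌋ x)` on the exterior algebra. -/
def numberOp (b : Module.Basis α K V) : ExteriorAlgebra K V →ₗ[K] ExteriorAlgebra K V :=
  ∑ i, LinearMap.mulLeft K (ι K (b i)) ∘ₗ contractLeft (Q := (0 : QuadraticForm K V)) (b.coord i)

theorem numberOp_apply (b : Module.Basis α K V) (x : ExteriorAlgebra K V) :
    numberOp b x = ∑ i, ι K (b i) * contractLeft (Q := (0 : QuadraticForm K V)) (b.coord i) x := by
  simp [numberOp]

theorem numberOp_ι_mul (b : Module.Basis α K V) (v : V) (x : ExteriorAlgebra K V) :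
    numberOp b (ι K v * x) = ι K v * x + ι K v * numberOp b x := by
  have hcomm (w : V) (y : ExteriorAlgebra K V) : ι K w * (ι K v * y) = -(ι K v * (ι K w * y)) := by
    rw [← mul_assoc, ← mul_assoc, ← neg_mul, eq_neg_of_add_eq_zero_left (ι_add_mul_swap w v)]
  have hv : ι K v = ∑ i, b.coord i v • ι K (b i) := by
    conv_lhs => rw [← b.sum_repr v, map_sum]
    simp only [map_smul, Module.Basis.coord_apply]
  have hterm (i : α) :
      ι K (b i) * contractLeft (Q := (0 : QuadraticForm K V)) (b.coord i) (ι K v * x) =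
        (b.coord i v • ι K (b i)) * x +
          ι K v * (ι K (b i) * contractLeft (Q := (0 : QuadraticForm K V)) (b.coord i) x) := by
    rw [contractLeft_ι_mul, mul_sub, hcomm, sub_neg_eq_add, mul_smul_comm, smul_mul_assoc]
  simp_rw [numberOp_apply, hterm]
  rw [Finset.sum_add_distrib, ← Finset.sum_mul, ← hv, Finset.mul_sum]

theorem numberOp_of_mem_exteriorPower (b : Module.Basis α K V) {k : ℕ} {x : ExteriorAlgebra K V}
    (hx : x ∈ ⋀[K]^k V) : numberOp b x = (k : K) • x := by
  induction hx using Submodule.pow_induction_on_left' with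
  | algebraMap r => simp [numberOp_apply]
  | add x y i _ _ hx hy => rw [map_add, hx, hy, smul_add]
  | mem_mul m hm i x _ hx =>
    obtain ⟨v, rfl⟩ := hm
    rw [numberOp_ι_mul, hx, mul_smul_comm, Nat.cast_succ, add_smul, one_smul, add_comm]

theorem decompose_numberOp (b : Module.Basis α K V) (x : ExteriorAlgebra K V) (k : ℕ) :
    DirectSum.decompose (fun i : ℕ ↦ ⋀[K]^i V) (numberOp b x) k =
      (k : K) • DirectSum.decompose (fun i : ℕ ↦ ⋀[K]^i V) x k := by
  induction x using DirectSum.Decomposition.inductionOn fun i : ℕ ↦ ⋀[K]^i V with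
  | zero => simp
  | add x y hx hy => simp [hx, hy]
  | @homogeneous i x =>
    rw [numberOp_of_mem_exteriorPower b x.2, DirectSum.decompose_smul, DirectSum.smul_apply,
      DirectSum.decompose_coe]
    by_cases h : i = k
    · subst h; rfl
    · simp [DirectSum.of_eq_of_ne _ _ _ (Ne.symm h)]

/-- A vector annihilated by the contractions with a dual basis is a scalar. -/
theorem mem_range_algebraMap_of_contractLeft_coord_eq_zero [CharZero K] (b : Module.Basis α K V)
    {x : ExteriorAlgebra K V}
    (hx : ∀ i, contractLeft (Q := (0 : QuadraticForm K V)) (b.coord i) x = 0) :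
    ∃ r : K, algebraMap K (ExteriorAlgebra K V) r = x := by
  classical
  have hN : numberOp b x = 0 := by simp [numberOp_apply, hx]
  have hk (k : ℕ) (hk : k ≠ 0) : DirectSum.decompose (fun i : ℕ ↦ ⋀[K]^i V) x k = 0 := by
    have h := decompose_numberOp b x k
    rw [hN, DirectSum.decompose_zero, DirectSum.zero_apply] at h
    exact (smul_eq_zero.mp h.symm).resolve_left (Nat.cast_ne_zero.mpr hk)
  have hx0 : x ∈ ⋀[K]^0 V := by
    rw [← DirectSum.sum_support_decompose (fun i : ℕ ↦ ⋀[K]^i V) x]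
    refine Submodule.sum_mem _ fun i _ ↦ ?_
    by_cases hi : i = 0
    · subst hi; exact SetLike.coe_mem _
    · rw [hk i hi]; exact Submodule.zero_mem _
  rwa [exteriorPower, pow_zero, Submodule.mem_one] at hx0

theorem exists_ne_zero_contractLeft_eq_zero {U : Submodule K (ExteriorAlgebra K V)} (hU : U ≠ ⊥)
    (hd : ∀ (d : Module.Dual K V), ∀ x ∈ U,
      contractLeft (Q := (0 : QuadraticForm K V)) d x ∈ U)
    {β : Type*} (d : β → Module.Dual K V) (s : Finset β) :
    ∃ x ∈ U, x ≠ 0 ∧ ∀ i ∈ s, contractLeft (Q := (0 : QuadraticForm K V)) (d i) x = 0 := by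
  classical
  induction s using Finset.induction_on with
  | empty =>
    obtain ⟨x, hx, hx0⟩ := Submodule.exists_mem_ne_zero_of_ne_bot hU
    exact ⟨x, hx, hx0, by simp⟩
  | insert a s _ ih =>
    obtain ⟨x, hx, hx0, hs⟩ := ih
    by_cases ha : contractLeft (Q := (0 : QuadraticForm K V)) (d a) x = 0
    · exact ⟨x, hx, hx0, Finset.forall_mem_insert _ _ _ |>.mpr ⟨ha, hs⟩⟩
    · refine ⟨_, hd (d a) x hx, ha, Finset.forall_mem_insert _ _ _ |>.mpr
        ⟨contractLeft_contractLeft _ _, fun i hi ↦ ?_⟩⟩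
      rw [contractLeft_comm, hs i hi, map_zero, neg_zero]

/-- A nonzero subspace of a finitely generated exterior algebra stable under all contractions
contains `1`. -/
theorem one_mem_of_contractLeft_mem [CharZero K] [FiniteDimensional K V]
    {U : Submodule K (ExteriorAlgebra K V)} (hU : U ≠ ⊥)
    (hd : ∀ (d : Module.Dual K V), ∀ x ∈ U,
      contractLeft (Q := (0 : QuadraticForm K V)) d x ∈ U) :
    (1 : ExteriorAlgebra K V) ∈ U := by
  let b := Module.finBasis K V
  obtain ⟨x, hx, hx0, h⟩ := exists_ne_zero_contractLeft_eq_zero hU hd b.coord Finset.univ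
  obtain ⟨r, rfl⟩ :=
    mem_range_algebraMap_of_contractLeft_coord_eq_zero b fun i ↦ h i (Finset.mem_univ i)
  have hr : r ≠ 0 := by rintro rfl; simp at hx0
  rwa [Algebra.algebraMap_eq_smul_one, Submodule.smul_mem_iff _ hr] at hx

theorem eq_top_of_one_mem_of_ι_mul_mem {U : Submodule K (ExteriorAlgebra K V)}
    (h1 : (1 : ExteriorAlgebra K V) ∈ U) (hι : ∀ (v : V), ∀ x ∈ U, ι K v * x ∈ U) : U = ⊤ := by
  rw [Submodule.eq_top_iff']
  intro x
  induction x using CliffordAlgebra.left_induction with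
  | algebraMap r => rw [Algebra.algebraMap_eq_smul_one]; exact U.smul_mem r h1
  | add x y hx hy => exact U.add_mem hx hy
  | ι_mul x v hx => exact hι v x hx

end ExteriorAlgebra

theorem fockOp_coe_cre (B : W →ₗ[ℂ] W →ₗ[ℂ] ℂ) (Wcre Wann : Submodule ℂ W)
    (hc : IsCompl Wcre Wann) (v : Wcre) (x : ExteriorAlgebra ℂ Wcre) :
    fockOp B Wcre Wann hc v x = ExteriorAlgebra.ι ℂ v * x := by
  simp [fockOp, Submodule.linearProjOfIsCompl]

theorem fockOp_coe_ann (B : W →ₗ[ℂ] W →ₗ[ℂ] ℂ) (Wcre Wann : Submodule ℂ W)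
    (hc : IsCompl Wcre Wann) (a : Wann) (x : ExteriorAlgebra ℂ Wcre) :
    fockOp B Wcre Wann hc a x =
      CliffordAlgebra.contractLeft (Q := (0 : QuadraticForm ℂ ↥Wcre))
        ((B a).comp Wcre.subtype) x := by
  simp [fockOp, Submodule.linearProjOfIsCompl]

/-- Every functional on `W_cre` is the pairing with an element of `W_ann`. -/
theorem exists_ann_eq_dual_cre [FiniteDimensional ℂ W] (B : W →ₗ[ℂ] W →ₗ[ℂ] ℂ)
    (hsymm : ∀ u v : W, B u v = B v u)
    (hnondeg : ∀ u : W, (∀ v : W, B u v = 0) → u = 0)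
    (Wcre Wann : Submodule ℂ W) (hc : IsCompl Wcre Wann)
    (hcre : ∀ u ∈ Wcre, ∀ v ∈ Wcre, B u v = 0) (d : Module.Dual ℂ Wcre) :
    ∃ a : Wann, (B a).comp Wcre.subtype = d := by
  let P : Wann →ₗ[ℂ] Wcre →ₗ[ℂ] ℂ := B.domRestrict₁₂ Wann Wcre
  have hinj : Function.Injective P.flip := by
    rw [injective_iff_map_eq_zero]
    intro u hu
    refine Subtype.ext (hnondeg u fun v ↦ ?_)
    obtain ⟨c, hcv, a, hav, rfl⟩ :=
      Submodule.mem_sup.mp (hc.sup_eq_top ▸ Submodule.mem_top : v ∈ Wcre ⊔ Wann)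
    have ha : B a u = 0 := LinearMap.congr_fun hu ⟨a, hav⟩
    rw [map_add, hcre u u.2 c hcv, hsymm, ha, add_zero]
  obtain ⟨a, ha⟩ := LinearMap.flip_injective_iff₁.mp hinj d
  exact ⟨a, ha⟩

/-- The Fock representation is irreducible, and every nonzero subrepresentation contains
the vacuum vector `1 ∈ Λ⁰(W_cre)`. -/
theorem fock_representation_irreducible
    [FiniteDimensional ℂ W]
    (B : W →ₗ[ℂ] W →ₗ[ℂ] ℂ)
    (hsymm : ∀ u v : W, B u v = B v u)
    (hnondeg : ∀ u : W, (∀ v : W, B u v = 0) → u = 0)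
    (Wcre Wann : Submodule ℂ W) (hc : IsCompl Wcre Wann)
    (hcre : ∀ u ∈ Wcre, ∀ v ∈ Wcre, B u v = 0)
    (hann : ∀ u ∈ Wann, ∀ v ∈ Wann, B u v = 0)
    (U : Submodule ℂ (ExteriorAlgebra ℂ Wcre))
    (hU : ∀ w : W, ∀ x ∈ U, fockOp B Wcre Wann hc w x ∈ U) :
    (U = ⊥ ∨ U = ⊤) ∧
    (U ≠ ⊥ → (1 : ExteriorAlgebra ℂ Wcre) ∈ U) := by
  have hcontract (d : Module.Dual ℂ Wcre) (x : ExteriorAlgebra ℂ Wcre) (hx : x ∈ U) :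
      CliffordAlgebra.contractLeft (Q := (0 : QuadraticForm ℂ ↥Wcre)) d x ∈ U := by
    obtain ⟨a, rfl⟩ := exists_ann_eq_dual_cre B hsymm hnondeg Wcre Wann hc hcre d
    rw [← fockOp_coe_ann B Wcre Wann hc]
    exact hU a x hx
  have hone (h : U ≠ ⊥) : (1 : ExteriorAlgebra ℂ Wcre) ∈ U :=
    ExteriorAlgebra.one_mem_of_contractLeft_mem h hcontract
  refine ⟨or_iff_not_imp_left.mpr fun h ↦
    ExteriorAlgebra.eq_top_of_one_mem_of_ι_mul_mem (hone h) fun v x hx ↦ ?_, hone⟩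
  rw [← fockOp_coe_cre B Wcre Wann hc]
  exact hU v x hx

end
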